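/- arXiv:math/0608269 — 2 statements merged into one kernel-verified Lean document; each statement's English description precedes it below -/
import Mathlib

section
/- For every n ≥ 3 and every finite k ≥ 4 there exists an n-ary quasigroup of order k (i.e., on a k-element set) that is not permutably reducible. -/
/-- An `n`-ary quasigroup on `S`. -/
def IsNQuasigroup {S : Type*} {n : ℕ} (f : (Fin n → S) → S) : Prop :=
  ∀ (i : Fin n) (x : Fin n → S), Function.Bijective fun a => f (Function.update x i a)

/-- Permutable reducibility. -/
def IsPermutablyReducible {S : Type*} {n : ℕ} (f : (Fin n → S) → S) : Prop :=
  ∃ (k : ℕ) (_ : 1 < k) (hkn : k < n) (σ : Equiv.Perm (Fin n))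
    (g : (Fin k → S) → S) (h : (Fin (n - k + 1) → S) → S),
    IsNQuasigroup g ∧ IsNQuasigroup h ∧
    ∀ x : Fin n → S,
      f x = h (Fin.cons (g fun j => x (σ ⟨j.1, lt_trans j.2 hkn⟩))
        (fun j : Fin (n - k) => x (σ ⟨k + j.1, by have := j.2; omega⟩)))

/-- The data on a binary operation that the construction needs: a loop with identity `e`,
a two-element subloop `{e, t}` and suitable elements `p`, `q`, `b`. -/
structure GoodOp {S : Type*} (op : S → S → S) (e t p q b : S) : Prop where
  left : ∀ x, Function.Bijective (op x)
  right : ∀ y, Function.Bijective fun x => op x y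
  one_op : ∀ x, op e x = x
  op_one : ∀ x, op x e = x
  tt : op t t = e
  te : t ≠ e
  pe : p ≠ e
  pt : p ≠ t
  be : b ≠ e
  bt : b ≠ t
  pb : op p b = e
  bp : op b p = e
  pq : op p q = t

/-- Left-normed iterated product. -/
def iterOp {S : Type*} (op : S → S → S) (e : S) : (n : ℕ) → (Fin n → S) → S
  | 0, _ => e
  | n + 1, x => op (iterOp op e n (Fin.init x)) (x (Fin.last n))

section
variable {S : Type*} {op : S → S → S} {e t p q b : S}

lemma iterOp_bij (H : GoodOp op e t p q b) : ∀ n, IsNQuasigroup (iterOp op e n) := by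
  intro n
  induction n with
  | zero => intro i; exact i.elim0
  | succ n ih =>
    intro i x
    induction i using Fin.lastCases with
    | last =>
      simp only [iterOp, Fin.init_update_last, Function.update_self]
      exact H.left _
    | cast i =>
      simp only [iterOp, Fin.init_update_castSucc]
      have h : ∀ a, Function.update x i.castSucc a (Fin.last n) = x (Fin.last n) := fun a =>
        Function.update_of_ne (Fin.castSucc_lt_last i).ne' _ _
      simp only [h]
      exact (H.right (x (Fin.last n))).comp (ih i (Fin.init x))

lemma iterOp_closed (H : GoodOp op e t p q b) : ∀ n (x : Fin n → S),
    (∀ i, x i = e ∨ x i = t) → iterOp op e n x = e ∨ iterOp op e n x = t := by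
  intro n
  induction n with
  | zero => intro x _; exact Or.inl rfl
  | succ n ih =>
    intro x hx
    simp only [iterOp]
    rcases ih (Fin.init x) (fun i => hx _) with h | h <;> rcases hx (Fin.last n) with h' | h' <;>
      rw [h, h'] <;> simp [H.one_op, H.op_one, H.tt]

lemma iterOp_one (H : GoodOp op e t p q b) : ∀ n, iterOp op e n (fun _ => e) = e := by
  intro n
  induction n with
  | zero => rfl
  | succ n ih =>
    simp only [iterOp, H.op_one]
    exact ih

lemma iterOp_update (H : GoodOp op e t p q b) : ∀ n (x : Fin n → S) (i : Fin n) (a : S),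
    (∀ j, i ≤ j → x j = e) →
    iterOp op e n (Function.update x i a) = op (iterOp op e n x) a := by
  intro n
  induction n with
  | zero => intro x i; exact i.elim0
  | succ n ih =>
    intro x i a hx
    have hl := hx (Fin.last n) (Fin.le_last i)
    induction i using Fin.lastCases with
    | last =>
      simp only [iterOp, Fin.init_update_last, Function.update_self, hl, H.op_one]
    | cast i =>
      have h : Function.update x i.castSucc a (Fin.last n) = x (Fin.last n) :=
        Function.update_of_ne (Fin.castSucc_lt_last i).ne' _ _
      simp only [iterOp, Fin.init_update_castSucc, h, hl, H.op_one]
      exact ih _ _ _ fun j hj => hx j.castSucc (by simpa using hj)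

lemma iterOp_three (H : GoodOp op e t p q b) (n : ℕ) (i j l : Fin n) (hij : i < j) (hjl : j < l)
    (u v w : S) :
    iterOp op e n (Function.update (Function.update (Function.update (fun _ => e) i u) j v) l w)
      = op (op u v) w := by
  have A : ∀ (m : Fin n) (m' : Fin n), m < m' → ∀ r, m' ≤ r → r ≠ m := by
    intro m m' h r h' h''; subst h''; exact absurd h (not_lt.2 h')
  rw [iterOp_update H, iterOp_update H, iterOp_update H, iterOp_one H, H.one_op]
  · intro r _; rfl
  · intro r hr; rw [Function.update_of_ne (A _ _ hij _ hr)]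
  · intro r hr
    rw [Function.update_of_ne (A _ _ hjl _ hr), Function.update_of_ne (A _ _ (hij.trans hjl) _ hr)]

open Classical in
/-- The product switched on the binary subcube. -/
noncomputable def switched (op : S → S → S) (e t : S) (n : ℕ) (x : Fin n → S) : S :=
  if ∀ i, x i = e ∨ x i = t then Equiv.swap e t (iterOp op e n x) else iterOp op e n x

lemma switched_quasi (H : GoodOp op e t p q b) (n : ℕ) : IsNQuasigroup (switched op e t n) := by
  classical
  intro i x
  have hb := iterOp_bij H n i x
  by_cases hx : ∀ j, j ≠ i → x j = e ∨ x j = t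
  · have key : ∀ a, (∀ j, Function.update x i a j = e ∨ Function.update x i a j = t) ↔
        (a = e ∨ a = t) := by
      intro a
      constructor
      · intro h; simpa using h i
      · intro h j
        by_cases hj : j = i
        · subst hj; simpa using h
        · rw [Function.update_of_ne hj]; exact hx j hj
    have ce := iterOp_closed H n _ ((key e).2 (Or.inl rfl))
    have ct := iterOp_closed H n _ ((key t).2 (Or.inr rfl))
    have inj : ∀ a c, iterOp op e n (Function.update x i a) = iterOp op e n (Function.update x i c)
      → a = c := fun a c h => hb.1 h
    have : (fun a => switched op e t n (Function.update x i a)) =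
        (Equiv.swap e t) ∘ fun a => iterOp op e n (Function.update x i a) := by
      funext a
      simp only [switched, key, Function.comp]
      split_ifs with h
      · rfl
      · push Not at h
        symm
        have hne := fun h' => H.te (inj t e h')
        have h1 := fun h' => h.1 (inj a e h')
        have h2 := fun h' => h.2 (inj a t h')
        apply Equiv.swap_apply_of_ne_of_ne <;> grind
    rw [this]
    exact (Equiv.bijective _).comp hb
  · push Not at hx
    obtain ⟨j, hj, h1, h2⟩ := hx
    have : (fun a => switched op e t n (Function.update x i a)) =
        fun a => iterOp op e n (Function.update x i a) := by
      funext a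
      rw [switched, if_neg]
      intro h
      have := h j
      rw [Function.update_of_ne hj] at this
      tauto
    rw [this]
    exact hb

lemma switched_of (n : ℕ) (x : Fin n → S) (i : Fin n) (h1 : x i ≠ e) (h2 : x i ≠ t) :
    switched op e t n x = iterOp op e n x := by
  classical
  rw [switched, if_neg]
  intro h
  have := h i
  tauto

/-- Consequence of reducibility: three coordinates `i, j` (inside) and `l` (outside). -/
lemma reducible_rule {n : ℕ} {f : (Fin n → S) → S} (hf : IsPermutablyReducible f) :
    ∃ i j l : Fin n, i ≠ j ∧ i ≠ l ∧ j ≠ l ∧ ∀ (x : Fin n → S) (u v u' v' w w' : S),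
      f (Function.update (Function.update (Function.update x i u) j v) l w) =
      f (Function.update (Function.update (Function.update x i u') j v') l w) →
      f (Function.update (Function.update (Function.update x i u) j v) l w') =
      f (Function.update (Function.update (Function.update x i u') j v') l w') := by
  obtain ⟨k, hk, hkn, σ, g, h, hg, hh, hf⟩ := hf
  refine ⟨σ ⟨0, by omega⟩, σ ⟨1, by omega⟩, σ ⟨k, hkn⟩, ?_, ?_, ?_, ?_⟩
  · intro h; simpa using σ.injective h
  · intro h; have := σ.injective h; simp at this; omega
  · intro h; have := σ.injective h; simp at this; omega
  have hinj : ∀ u u' r, h (Fin.cons u r) = h (Fin.cons u' r) → u = u' := by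
    intro u u' r hr
    apply (hh 0 (Fin.cons u r)).1
    simpa using hr
  intro x u v u' v' w w' hyp
  rw [hf, hf] at hyp ⊢
  have inA : ∀ (y : Fin n → S) (w : S), (fun j : Fin k =>
      Function.update y (σ ⟨k, hkn⟩) w (σ ⟨j.1, lt_trans j.2 hkn⟩)) =
      fun j : Fin k => y (σ ⟨j.1, lt_trans j.2 hkn⟩) := by
    intro y w
    funext j
    rw [Function.update_of_ne]
    intro h
    have := σ.injective h
    have h2 := j.2
    simp at this; omega
  have inB : ∀ (u v u' v' w : S), (fun j : Fin (n - k) =>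
      Function.update (Function.update (Function.update x (σ ⟨0, by omega⟩) u)
        (σ ⟨1, by omega⟩) v) (σ ⟨k, hkn⟩) w
        (σ ⟨k + j.1, by have := j.2; omega⟩)) = fun j : Fin (n - k) =>
      Function.update (Function.update (Function.update x (σ ⟨0, by omega⟩) u')
        (σ ⟨1, by omega⟩) v') (σ ⟨k, hkn⟩) w
        (σ ⟨k + j.1, by have := j.2; omega⟩) := by
    intro u v u' v' w
    funext j
    have h0 : σ ⟨k + j.1, by have := j.2; omega⟩ ≠ σ ⟨0, by omega⟩ := by
      intro h; have := σ.injective h; simp at this; omega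
    have h1 : σ ⟨k + j.1, by have := j.2; omega⟩ ≠ σ ⟨1, by omega⟩ := by
      intro h; have := σ.injective h; simp at this; omega
    simp only [Function.update_apply, h0, h1, if_false]
  rw [inB u v u' v' w] at hyp
  rw [inB u v u' v' w']
  have := hinj _ _ _ hyp
  rw [inA, inA] at this
  rw [inA, inA, this]

lemma switched_irred_aux (H : GoodOp op e t p q b) (n : ℕ) (i j l : Fin n) (hij : i < j)
    (hil : i ≠ l) (hjl : j ≠ l)
    (hr : switched op e t n (Function.update (Function.update (Function.update (fun _ => e) i e) j e) l e) =
      switched op e t n (Function.update (Function.update (Function.update (fun _ => e) i p) j q) l e) →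
      switched op e t n (Function.update (Function.update (Function.update (fun _ => e) i e) j e) l b) =
      switched op e t n (Function.update (Function.update (Function.update (fun _ => e) i p) j q) l b)) :
    False := by
  classical
  -- the value of the iterated product at such points
  have val : ∀ u v w, iterOp op e n
      (Function.update (Function.update (Function.update (fun _ => e) i u) j v) l w) =
      if j < l then op (op u v) w else if i < l then op (op u w) v else op (op w u) v := by
    intro u v w
    split_ifs with h1 h2
    · exact iterOp_three H n i j l hij h1 u v w
    · have h3 : l < j := lt_of_le_of_ne (not_lt.1 h1) hjl.symm
      rw [Function.update_comm hjl]
      exact iterOp_three H n i l j h2 h3 u w v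
    · have h3 : l < i := lt_of_le_of_ne (not_lt.1 h2) hil.symm
      rw [Function.update_comm hjl, Function.update_comm hil]
      exact iterOp_three H n l i j h3 hij w u v
  have atp : ∀ w, Function.update (Function.update (Function.update (fun _ => e) i p) j q) l w i
      = p := by
    intro w
    rw [Function.update_of_ne hil, Function.update_of_ne hij.ne, Function.update_self]
  have atb : ∀ u v, Function.update (Function.update (Function.update (fun _ => e) i u) j v) l b l
      = b := by
    intro u v
    rw [Function.update_self]
  have h0 : switched op e t n
      (Function.update (Function.update (Function.update (fun _ => e) i e) j e) l e) = t := by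
    have : Function.update (Function.update (Function.update (fun _ => e) i e) j e) l e
      = fun _ : Fin n => e := by simp
    rw [this, switched, if_pos (fun _ => Or.inl rfl), iterOp_one H, Equiv.swap_apply_left]
  have sp : ∀ w, switched op e t n
      (Function.update (Function.update (Function.update (fun _ => e) i p) j q) l w) = _ :=
    fun w => switched_of n _ i (by rw [atp]; exact H.pe) (by rw [atp]; exact H.pt)
  have sb : ∀ u v, switched op e t n
      (Function.update (Function.update (Function.update (fun _ => e) i u) j v) l b) = _ :=
    fun u v => switched_of n _ l (by rw [atb]; exact H.be) (by rw [atb]; exact H.bt)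
  rw [h0, sp, sb, sp, val, val, val] at hr
  simp only [H.op_one, H.one_op, H.pq, H.pb, H.bp, ite_self, true_imp_iff] at hr
  have hqb : b ≠ q := by
    rintro rfl
    exact H.te (H.pq.symm.trans H.pb)
  split_ifs at hr with h1
  · apply H.te
    apply (H.right b).1
    simp only [H.one_op, ← hr]
  · exact hqb hr

lemma switched_irred (H : GoodOp op e t p q b) (n : ℕ) :
    ¬ IsPermutablyReducible (switched op e t n) := by
  intro hf
  obtain ⟨i, j, l, hij, hil, hjl, hr⟩ := reducible_rule hf
  rcases lt_or_gt_of_ne hij with h | h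
  · exact switched_irred_aux H n i j l h hil hjl (hr _ e e p q e b)
  · refine switched_irred_aux H n j i l h hjl hil ?_
    have := hr (fun _ => e) e e q p e b
    have c : ∀ u v : S, Function.update (Function.update (fun _ : Fin n => e) i u) j v =
        Function.update (Function.update (fun _ : Fin n => e) j v) i u := by
      intro u v
      rw [Function.update_comm hij]
    rwa [c, c] at this

end

lemma GoodOp.transport {S T : Type*} {op : S → S → S} {e t p q b : S} (H : GoodOp op e t p q b)
    (E : S ≃ T) : GoodOp (fun x y => E (op (E.symm x) (E.symm y))) (E e) (E t) (E p) (E q) (E b) where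
  left x := E.bijective.comp ((H.left _).comp E.symm.bijective)
  right y := E.bijective.comp ((H.right (E.symm y)).comp E.symm.bijective)
  one_op x := by simp [H.one_op]
  op_one x := by simp [H.op_one]
  tt := by simp [H.tt]
  te := by simpa using H.te
  pe := by simpa using H.pe
  pt := by simpa using H.pt
  be := by simpa using H.be
  bt := by simpa using H.bt
  pb := by simp [H.pb]
  bp := by simp [H.bp]
  pq := by simp [H.pq]

lemma goodOp_even (m : ℕ) (hm : 2 ≤ m) :
    GoodOp (fun x y : ZMod m × ZMod 2 => x + y) 0 (0, 1) (1, 0) (-1, 1) (-1, 0) := by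
  haveI : Fact (1 < m) := ⟨hm⟩
  refine ⟨fun x => (Equiv.addLeft x).bijective, fun x => (Equiv.addRight x).bijective,
    by simp, by simp, ?_, ?_, ?_, ?_, ?_, ?_, ?_, ?_, ?_⟩ <;> simp [Prod.ext_iff] <;> decide

/-- A loop of order `m + 2` for `m` odd. -/
def oddOp (m : ℕ) (h : ZMod m) : ZMod m ⊕ Bool → ZMod m ⊕ Bool → ZMod m ⊕ Bool
  | .inl x, .inl y => if x = y then .inr false else if y = x + 2 then .inr true
      else .inl (h * (x + y))
  | .inl x, .inr false => .inl x
  | .inl x, .inr true => .inl (x + 1)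
  | .inr false, .inl y => .inl y
  | .inr true, .inl y => .inl (y - 1)
  | .inr u, .inr v => .inr (xor u v)

lemma goodOp_odd (m : ℕ) [NeZero m] (hm : 3 ≤ m) (h : ZMod m) (hh : 2 * h = 1) :
    GoodOp (oddOp m h) (.inr false) (.inr true) (.inl 0) (.inl 2) (.inl 0) := by
  haveI : Fact (1 < m) := ⟨by omega⟩
  have h2 : (2 : ZMod m) ≠ 0 := by
    intro h0
    rw [h0, zero_mul] at hh
    exact zero_ne_one hh
  have hc : ∀ a c : ZMod m, h * a = c → a = 2 * c := by
    intro a c hac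
    rw [← hac, ← mul_assoc, hh, one_mul]
  have h1 : (1 : ZMod m) ≠ 0 := one_ne_zero
  refine ⟨fun x => Finite.injective_iff_bijective.1 ?_, fun x => Finite.injective_iff_bijective.1 ?_,
    ?_, ?_, ?_, ?_, ?_, ?_, ?_, ?_, ?_, ?_, ?_⟩
  · rintro (y | _ | _) (z | _ | _) hyz <;> rcases x with (x | _ | _) <;>
      simp only [oddOp] at hyz <;> grind
  · rintro (y | _ | _) (z | _ | _) hyz <;> rcases x with (x | _ | _) <;>
      simp only [oddOp] at hyz <;> grind
  · rintro (y | _ | _) <;> simp [oddOp]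
  · rintro (y | _ | _) <;> simp [oddOp]
  all_goals simp [oddOp, h2.symm]

/-- For every `n ≥ 3` and finite `k ≥ 4` there exists a permutably irreducible
`n`-ary quasigroup of order `k`. -/
theorem exists_irreducible_nquasigroup :
    ∀ n k : ℕ, 3 ≤ n → 4 ≤ k →
      ∃ f : (Fin n → Fin k) → Fin k, IsNQuasigroup f ∧ ¬ IsPermutablyReducible f := by
  intro n k _ hk
  rcases Nat.even_or_odd' k with ⟨m, rfl | rfl⟩
  · have hm : 2 ≤ m := by omega
    haveI : NeZero m := ⟨by omega⟩
    have E : ZMod m × ZMod 2 ≃ Fin (2 * m) :=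
      Fintype.equivFinOfCardEq (by simp [ZMod.card, mul_comm])
    have H := (goodOp_even m hm).transport E
    exact ⟨_, switched_quasi H n, switched_irred H n⟩
  · obtain ⟨r, rfl⟩ : ∃ r, m = r + 2 := ⟨m - 2, by omega⟩
    have hh : (2 : ZMod (2 * r + 3)) * ((r + 2 : ℕ) : ZMod (2 * r + 3)) = 1 := by
      have := ZMod.natCast_self (2 * r + 3)
      push_cast at this ⊢
      linear_combination this
    have E : ZMod (2 * r + 3) ⊕ Bool ≃ Fin (2 * (r + 2) + 1) :=
      Fintype.equivFinOfCardEq (by simp [ZMod.card]; ring)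
    have H := (goodOp_odd (2 * r + 3) (by omega) _ hh).transport E
    exact ⟨_, switched_quasi H n, switched_irred H n⟩
end

section
/- For every finite k > 3 and every n ≥ 2, the number |Q(n,k)| of n-ary quasigroups on a fixed k-element set satisfies: (a) if k is even then |Q(n,k)| ≥ 2^{(k/2)^n}; (b) if k is divisible by 3 then |Q(n,k)| ≥ 2^{n·(k/3)^n}; (c) if k = 5 then |Q(n,5)| ≥ 2^{3^{n/3 − c}} where c < 0.072 depends only on n mod 3; (d) in all other cases (k odd, not divisible by 3, k ≥ 7) |Q(n,k)| ≥ 2^{⌊k/2⌋·⌊k/3⌋^{n−1}} ≥ 2^{1.5·⌊k/3⌋^n}. -/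
/-- `|Q(n,k)|`: the number of `n`-ary quasigroup operations on a fixed
`k`-element set. -/
noncomputable def numQuasigroups (n k : ℕ) : ℕ :=
  Nat.card {f : (Fin n → Fin k) → Fin k // IsNQuasigroup f}

namespace QG

open Function

/-- quasigroup (cancellation form) with arbitrary index type -/
def IsQ {I S : Type} [DecidableEq I] (f : (I → S) → S) : Prop :=
  ∀ (i : I) (x : I → S) (a b : S), f (update x i a) = f (update x i b) → a = b

theorem card_le {I S W : Type} [DecidableEq I] [Fintype I] [Fintype S] [Fintype W]
    (n k : ℕ) (hI : Fintype.card I = n) (hS : Fintype.card S = k)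
    (F : W → (I → S) → S) (hF : Injective F) (hq : ∀ w, IsQ (F w)) :
    Fintype.card W ≤ numQuasigroups n k := by
  classical
  have eI : I ≃ Fin n := Fintype.equivFinOfCardEq hI
  have eS : S ≃ Fin k := Fintype.equivFinOfCardEq hS
  have key : ∀ w, IsNQuasigroup
      (fun x : Fin n → Fin k => eS (F w (fun i => eS.symm (x (eI i))))) := by
    intro w i x
    apply Finite.injective_iff_bijective.mp
    intro a b hab
    have hab' := eS.injective hab
    have hu : ∀ a, (fun j => eS.symm (update x i a (eI j)))
        = update (fun j => eS.symm (x (eI j))) (eI.symm i) (eS.symm a) := by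
      intro a
      funext j
      by_cases hj : eI j = i
      · have : j = eI.symm i := by rw [← hj]; simp
        subst this
        simp
      · have : j ≠ eI.symm i := by rintro rfl; simp at hj
        simp [hj, this]
    rw [hu, hu] at hab'
    exact eS.symm.injective (hq w _ _ _ _ hab')
  unfold numQuasigroups
  rw [← Nat.card_eq_fintype_card]
  apply Nat.card_le_card_of_injective (fun w => (⟨_, key w⟩ :
    {f : (Fin n → Fin k) → Fin k // IsNQuasigroup f}))
  intro w w' h
  apply hF
  funext x
  have h1 := congrFun (Subtype.mk.inj h) (fun i => eS (x (eI.symm i)))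
  simpa using h1

/-- product construction -/
theorem prod_bound {A B V : Type} [AddCommGroup A] [Fintype A] [Fintype B] [Fintype V]
    (n k : ℕ) (hk : Fintype.card A * Fintype.card B = k)
    (q : V → (Fin n → B) → B) (hqi : Injective q) (hq : ∀ v, IsQ (q v)) :
    Fintype.card V ^ (Fintype.card A ^ n) ≤ numQuasigroups n k := by
  classical
  have hc : Fintype.card ((Fin n → A) → V) = Fintype.card V ^ (Fintype.card A ^ n) := by
    simp
  rw [← hc]
  refine card_le (I := Fin n) (S := A × B) n k (by simp) (by simp [hk])
    (fun φ x => (∑ i, (x i).1, q (φ (fun i => (x i).1)) (fun i => (x i).2))) ?_ ?_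
  · intro φ ψ h
    funext a
    apply hqi
    funext b
    have := congrFun h (fun i => (a i, b i))
    simpa using this
  · rintro φ i x ⟨a, b⟩ ⟨a', b'⟩ h
    have h1 : ∀ (a : A) (b : B), (fun j => (update x i (a, b) j).1)
        = update (fun j => (x j).1) i a := by
      intro a b; funext j
      by_cases hj : j = i
      · subst hj; simp
      · simp [hj]
    have h2 : ∀ (a : A) (b : B), (fun j => (update x i (a, b) j).2)
        = update (fun j => (x j).2) i b := by
      intro a b; funext j
      by_cases hj : j = i
      · subst hj; simp
      · simp [hj]
    have e1 := congrArg Prod.fst h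
    have e2 := congrArg Prod.snd h
    simp only [] at e1 e2
    rw [h1, h2, h1, h2] at e2
    have s1 : ∀ (a : A) (b : B), ∑ j, (update x i (a, b) j).1
        = a + ∑ j ∈ Finset.univ \ {i}, (x j).1 := by
      intro a b
      have := Finset.sum_update_of_mem (Finset.mem_univ i) (fun j => (x j).1) a
      rw [← this, ← h1 a b]
    rw [s1, s1] at e1
    have ha := add_right_cancel e1
    subst ha
    have hb := hq _ _ _ _ _ e2
    subst hb
    rfl

theorem part_a (n k : ℕ) (hk : 3 < k) (h2 : 2 ∣ k) :
    2 ^ (k / 2) ^ n ≤ numQuasigroups n k := by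
  obtain ⟨m, rfl⟩ := h2
  have hm : NeZero m := ⟨by omega⟩
  have := prod_bound (A := ZMod m) (B := ZMod 2) (V := ZMod 2) n (2 * m)
    (by simp [ZMod.card]; ring) (fun v x => v + ∑ i, x i) ?_ ?_
  · simpa [ZMod.card] using this
  · intro v w h
    have := congrFun h 0
    simpa using this
  · intro v i x a b h
    simp only [Finset.sum_update_of_mem (Finset.mem_univ i)] at h
    exact add_right_cancel (add_left_cancel h)

theorem part_b (n k : ℕ) (hk : 3 < k) (h2 : 3 ∣ k) :
    2 ^ (n * (k / 3) ^ n) ≤ numQuasigroups n k := by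
  obtain ⟨m, rfl⟩ := h2
  have hm : NeZero m := ⟨by omega⟩
  have := prod_bound (A := ZMod m) (B := ZMod 3) (V := Fin n → Bool) n (3 * m)
    (by simp [ZMod.card]; ring)
    (fun v x => ∑ i, (if v i then 1 else 2) * x i) ?_ ?_
  · simpa [ZMod.card, pow_mul] using this
  · intro v w h
    funext i
    have := congrFun h (Pi.single i 1)
    simp [Pi.single_apply] at this
    revert this
    cases v i <;> cases w i <;> decide
  · intro v i x a b h
    have s1 : ∀ a : ZMod 3, ∑ j, (if v j then (1 : ZMod 3) else 2) * update x i a j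
        = (if v i then 1 else 2) * a
          + ∑ j ∈ Finset.univ \ {i}, (if v j then (1 : ZMod 3) else 2) * x j := by
      intro a
      rw [← Finset.sum_update_of_mem (Finset.mem_univ i)
        (fun j => (if v j then (1 : ZMod 3) else 2) * x j)]
      apply Finset.sum_congr rfl
      intro j _
      by_cases hj : j = i
      · subst hj; simp
      · simp [hj]
    simp only [s1] at h
    have h' := add_right_cancel h
    revert h'
    clear h s1
    cases v i <;> revert a b <;> decide

/-- a switching structure -/
structure Good {I S ι : Type} [DecidableEq I] (σ : S → S) (f : (I → S) → S)
    (c : (I → S) → Option ι) : Prop where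
  q : IsQ f
  line : ∀ x i a, f (update x i a) = σ (f x) → c (update x i a) = c x

theorem Good.count {I S ι : Type} [DecidableEq I] [Fintype I] [Fintype S]
    {σ : S → S} (hσ : Involutive σ) {f : (I → S) → S} {c : (I → S) → Option ι}
    (hg : Good σ f c) (n k : ℕ) (hI : Fintype.card I = n) (hS : Fintype.card S = k)
    (H : Finset ι) (hH : ∀ t ∈ H, ∃ x, c x = some t ∧ σ (f x) ≠ f x) :
    2 ^ H.card ≤ numQuasigroups n k := by
  classical
  let s : (H → Bool) → Option ι → Prop := fun φ o => ∃ t : H, o = some t.1 ∧ φ t = true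
  have hc : Fintype.card (H → Bool) = 2 ^ H.card := by simp
  rw [← hc]
  refine card_le n k hI hS (fun φ x => if s φ (c x) then σ (f x) else f x) ?_ ?_
  · intro φ ψ h
    funext t
    obtain ⟨x, hx, hx'⟩ := hH t.1 t.2
    have hs : ∀ φ : H → Bool, s φ (c x) ↔ φ t = true := by
      intro φ
      constructor
      · rintro ⟨u, hu, hu'⟩
        rw [hx] at hu
        have : t = u := Subtype.ext (Option.some.inj hu)
        rw [this]; exact hu'
      · intro h; exact ⟨t, hx, h⟩
    have e := congrFun h x
    simp only [hs] at e
    cases h1 : φ t <;> cases h2 : ψ t <;> simp [h1, h2] at e ⊢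
    · exact hx' e.symm
    · exact hx' e
  · intro φ i x a b h
    simp only [] at h
    have L : ∀ a b, f (update x i a) = σ (f (update x i b)) →
        c (update x i a) = c (update x i b) := by
      intro a b hab
      have := hg.line (update x i b) i a
      rw [update_idem] at this
      exact this hab
    by_cases h1 : s φ (c (update x i a)) <;> by_cases h2 : s φ (c (update x i b))
    · rw [if_pos h1, if_pos h2] at h
      exact hg.q _ _ _ _ (hσ.injective h)
    · rw [if_pos h1, if_neg h2] at h
      rw [L b a h.symm] at h2
      exact absurd h1 h2
    · rw [if_neg h1, if_pos h2] at h
      rw [L a b h] at h1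
      exact absurd h2 h1
    · rw [if_neg h1, if_neg h2] at h
      exact hg.q _ _ _ _ h

/-- composition -/
def comb {I J S : Type} (L : S → S → S) (f : (I → S) → S) (g : (J → S) → S) :
    (I ⊕ J → S) → S := fun x => L (f (x ∘ Sum.inl)) (g (x ∘ Sum.inr))

open Classical in
/-- restricted label -/
noncomputable def lab {ι : Type} (p : Prop) (o : Option ι) : Option ι := if p then o else none

theorem lab_pos {ι : Type} {p : Prop} (o : Option ι) (h : p) : lab p o = o := if_pos h

theorem lab_neg {ι : Type} {p : Prop} (o : Option ι) (h : ¬ p) : lab p o = none := if_neg h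

/-- labels of the composition -/
noncomputable def combL {I J S ι κ : Type} (R : S → S → Prop)
    (f : (I → S) → S) (g : (J → S) → S)
    (c : (I → S) → Option ι) (d : (J → S) → Option κ) :
    (I ⊕ J → S) → Option (ι × κ) := fun x =>
  lab (R (f (x ∘ Sum.inl)) (g (x ∘ Sum.inr)))
    ((c (x ∘ Sum.inl)).bind fun t => (d (x ∘ Sum.inr)).map fun u => (t, u))

/-- binary operation compatible with the involution on a region -/
structure Compat {S : Type} (σ : S → S) (L : S → S → S) (R : S → S → Prop) : Prop where
  inv : Involutive σ
  l : ∀ a b c, L a b = L a c → b = c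
  r : ∀ a b c, L b a = L c a → b = c
  sl : ∀ a b, R a b → L (σ a) b = σ (L a b) ∧ R (σ a) b
  sr : ∀ a b, R a b → L a (σ b) = σ (L a b) ∧ R a (σ b)

theorem Good.comb {I J S ι κ : Type} [DecidableEq I] [DecidableEq J]
    {σ : S → S} {L : S → S → S} {R : S → S → Prop} (hL : Compat σ L R)
    {f : (I → S) → S} {c : (I → S) → Option ι} (hf : Good σ f c)
    {g : (J → S) → S} {d : (J → S) → Option κ} (hg : Good σ g d) :
    Good σ (comb L f g) (combL R f g c d) := by
  have ul : ∀ (x : I ⊕ J → S) (i : I) (a : S),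
      update x (Sum.inl i) a ∘ Sum.inl = update (x ∘ Sum.inl) i a := by
    intro x i a; funext j
    by_cases hj : j = i
    · subst hj; simp
    · simp [hj]
  have ul' : ∀ (x : I ⊕ J → S) (i : I) (a : S),
      update x (Sum.inl i) a ∘ Sum.inr = x ∘ Sum.inr := by
    intro x i a; funext j; simp
  have ur : ∀ (x : I ⊕ J → S) (i : J) (a : S),
      update x (Sum.inr i) a ∘ Sum.inr = update (x ∘ Sum.inr) i a := by
    intro x i a; funext j
    by_cases hj : j = i
    · subst hj; simp
    · simp [hj]
  have ur' : ∀ (x : I ⊕ J → S) (i : J) (a : S),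
      update x (Sum.inr i) a ∘ Sum.inl = x ∘ Sum.inl := by
    intro x i a; funext j; simp
  constructor
  · rintro (i | i) x a b h
    · simp only [QG.comb, ul, ul'] at h
      exact hf.q _ _ _ _ (hL.r _ _ _ h)
    · simp only [QG.comb, ur, ur'] at h
      exact hg.q _ _ _ _ (hL.l _ _ _ h)
  · rintro x (i | i) a h
    · simp only [QG.comb, ul, ul'] at h
      simp only [combL, ul, ul']
      generalize x ∘ Sum.inr = y at *
      generalize x ∘ Sum.inl = z at *
      by_cases h1 : R (f z) (g y)
      · have e := hL.sl _ _ h1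
        rw [← e.1] at h
        have e2 := hL.r _ _ _ h
        rw [hf.line _ _ _ e2, e2, lab_pos _ h1, lab_pos _ e.2]
      · rw [lab_neg _ h1]
        by_cases h2 : R (f (update z i a)) (g y)
        · exfalso
          have e := hL.sl _ _ h2
          rw [h, hL.inv] at e
          have e2 := hL.r _ _ _ e.1
          rw [e2] at e
          exact h1 e.2
        · rw [lab_neg _ h2]
    · simp only [QG.comb, ur, ur'] at h
      simp only [combL, ur, ur']
      generalize x ∘ Sum.inr = y at *
      generalize x ∘ Sum.inl = z at *
      by_cases h1 : R (f z) (g y)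
      · have e := hL.sr _ _ h1
        rw [← e.1] at h
        have e2 := hL.l _ _ _ h
        rw [hg.line _ _ _ e2, e2, lab_pos _ h1, lab_pos _ e.2]
      · rw [lab_neg _ h1]
        by_cases h2 : R (f z) (g (update y i a))
        · exfalso
          have e := hL.sr _ _ h2
          rw [h, hL.inv] at e
          have e2 := hL.l _ _ _ e.1
          rw [e2] at e
          exact h1 e.2
        · rw [lab_neg _ h2]

theorem comb_hit {I J S ι κ : Type} (L : S → S → S) {R : S → S → Prop}
    {f : (I → S) → S} {c : (I → S) → Option ι} {g : (J → S) → S} {d : (J → S) → Option κ}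
    (x : I → S) (y : J → S) (t : ι) (u : κ) (hx : c x = some t) (hy : d y = some u)
    (hR : R (f x) (g y)) :
    combL R f g c d (Sum.elim x y) = some (t, u) ∧
      comb L f g (Sum.elim x y) = L (f x) (g y) := by
  constructor
  · simp only [combL, Sum.elim_comp_inl, Sum.elim_comp_inr]
    rw [lab_pos _ hR, hx, hy]; rfl
  · simp only [comb, Sum.elim_comp_inl, Sum.elim_comp_inr]

/-! ### order 5 -/

/-- Latin square of order 5 with a subsquare of order 2 -/
def L5 : Fin 5 → Fin 5 → Fin 5 :=
  ![![0, 1, 2, 3, 4], ![1, 0, 3, 4, 2], ![2, 3, 4, 0, 1], ![3, 4, 1, 2, 0], ![4, 2, 0, 1, 3]]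

/-- swap 0 and 1 -/
def s5 : Fin 5 → Fin 5 := ![1, 0, 2, 3, 4]

theorem compat5 : Compat s5 L5 (fun a b => s5 a ≠ a ∧ s5 b ≠ b) where
  inv := by unfold Involutive; decide
  l := by decide
  r := by decide
  sl := by decide
  sr := by decide

/-- labels, two arguments -/
def c52 (a b : Fin 5) : Option (Fin 3) :=
  if a ≤ 1 ∧ b ≤ 1 then some 0 else if 2 ≤ a ∧ 2 ≤ b then some 1 else none

/-- labels, three arguments -/
def c53 (a b c : Fin 5) : Option (Fin 3) :=
  if a ≤ 1 ∧ L5 b c ≤ 1 then c52 b c else if 2 ≤ a ∧ 2 ≤ L5 b c then some 2 else none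

/-- existence of a switching structure of order 5 with `N` components -/
def T (n N : ℕ) : Prop := ∃ (I : Type) (_ : Fintype I) (_ : DecidableEq I)
  (f : (I → Fin 5) → Fin 5) (ι : Type) (c : (I → Fin 5) → Option ι) (H : Finset ι),
  Fintype.card I = n ∧ H.card = N ∧ Good s5 f c ∧
    ∀ t ∈ H, ∃ x, c x = some t ∧ s5 (f x) ≠ f x

theorem T.mul {n m N M : ℕ} (h1 : T n N) (h2 : T m M) : T (n + m) (N * M) := by
  obtain ⟨I, _, _, f, ι, c, H, rfl, rfl, hf, hH⟩ := h1
  obtain ⟨J, _, _, g, κ, d, K, rfl, rfl, hg, hK⟩ := h2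
  refine ⟨I ⊕ J, inferInstance, inferInstance, comb L5 f g, ι × κ, _, H ×ˢ K, by simp, by simp,
    hf.comb compat5 hg, ?_⟩
  rintro ⟨t, u⟩ htu
  obtain ⟨ht, hu⟩ := Finset.mem_product.mp htu
  obtain ⟨x, hx, hx'⟩ := hH t ht
  obtain ⟨y, hy, hy'⟩ := hK u hu
  have := comb_hit L5 (R := fun a b => s5 a ≠ a ∧ s5 b ≠ b) (f := f) (g := g)
    x y t u hx hy ⟨hx', hy'⟩
  refine ⟨Sum.elim x y, this.1, ?_⟩
  rw [this.2]
  revert hx' hy'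
  generalize f x = a
  generalize g y = b
  revert a b
  decide

theorem T2 : T 2 2 := by
  refine ⟨Fin 2, inferInstance, inferInstance, fun x => L5 (x 0) (x 1), Fin 3,
    fun x => c52 (x 0) (x 1), {0, 1}, by simp, by simp, ⟨?_, ?_⟩, ?_⟩
  · intro i x a b
    fin_cases i <;> simp <;> generalize x 0 = u <;> generalize x 1 = v <;> revert u v a b <;>
      decide +kernel
  · intro x i a
    fin_cases i <;> simp <;> generalize x 0 = u <;> generalize x 1 = v <;> revert u v a <;>
      decide +kernel
  · intro t ht
    simp at ht
    rcases ht with rfl | rfl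
    · exact ⟨![0, 0], by decide +kernel, by decide +kernel⟩
    · exact ⟨![2, 3], by decide +kernel, by decide +kernel⟩

theorem T3 : T 3 3 := by
  refine ⟨Fin 3, inferInstance, inferInstance, fun x => L5 (x 0) (L5 (x 1) (x 2)), Fin 3,
    fun x => c53 (x 0) (x 1) (x 2), {0, 1, 2}, by simp, by simp, ⟨?_, ?_⟩, ?_⟩
  · intro i x a b
    fin_cases i <;> simp <;> generalize x 0 = u <;> generalize x 1 = v <;>
      generalize x 2 = w <;> revert u v w a b <;> decide +kernel
  · intro x i a
    fin_cases i <;> simp <;> generalize x 0 = u <;> generalize x 1 = v <;>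
      generalize x 2 = w <;> revert u v w a <;> decide +kernel
  · intro t ht
    simp at ht
    rcases ht with rfl | rfl | rfl
    · exact ⟨![0, 0, 0], by decide +kernel, by decide +kernel⟩
    · exact ⟨![0, 2, 3], by decide +kernel, by decide +kernel⟩
    · exact ⟨![2, 0, 3], by decide +kernel, by decide +kernel⟩

theorem T.count {n N : ℕ} (h : T n N) : 2 ^ N ≤ numQuasigroups n 5 := by
  obtain ⟨I, _, _, f, ι, c, H, rfl, rfl, hf, hH⟩ := h
  exact hf.count compat5.inv _ _ rfl (by simp) H hH

theorem two_ge : (3 : ℝ) ^ ((41 : ℝ) / 65) ≤ 2 := by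
  have h : ((3 : ℝ) ^ ((41 : ℝ) / 65)) ^ (65 : ℕ) ≤ 2 ^ (65 : ℕ) := by
    rw [← Real.rpow_natCast, ← Real.rpow_mul (by norm_num)]
    have : (41 : ℝ) / 65 * ((65 : ℕ) : ℝ) = ((41 : ℕ) : ℝ) := by norm_num
    rw [this, Real.rpow_natCast]
    norm_num
  exact le_of_pow_le_pow_left₀ (by norm_num) (by norm_num) h

theorem T_exists : ∀ n : ℕ, ∃ N : ℕ, T (n + 2) N ∧ 2 ≤ N ∧
    (3 : ℝ) ^ (((n + 2 : ℕ) : ℝ) / 3 - 14 / 195) ≤ N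
  | 0 => ⟨2, T2, le_rfl, by
      refine le_trans ?_ (two_ge.trans (by norm_num))
      apply Real.rpow_le_rpow_of_exponent_le <;> norm_num⟩
  | 1 => ⟨3, T3, by norm_num, by
      have : (3 : ℝ) ^ (1 : ℝ) ≤ ((3 : ℕ) : ℝ) := by norm_num
      refine le_trans ?_ this
      apply Real.rpow_le_rpow_of_exponent_le <;> norm_num⟩
  | 2 => ⟨4, T2.mul T2, by norm_num, by
      have h := mul_le_mul two_ge two_ge (by positivity) (by norm_num)
      rw [← Real.rpow_add (by norm_num)] at h
      refine le_trans (le_of_eq ?_) (h.trans (by norm_num))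
      norm_num⟩
  | n + 3 => by
      obtain ⟨N, h1, h2, h3⟩ := T_exists n
      refine ⟨N * 3, h1.mul T3, by omega, ?_⟩
      have : (((n + 3 + 2 : ℕ) : ℝ) / 3 - 14 / 195) = (((n + 2 : ℕ) : ℝ) / 3 - 14 / 195) + 1 := by
        push_cast; ring
      rw [this, Real.rpow_add (by norm_num), Real.rpow_one]
      push_cast
      exact mul_le_mul_of_nonneg_right (by exact_mod_cast h3) (by norm_num)

/-! ### odd orders -/

/-- idempotent quasigroup -/
structure Idem {A : Type} (Q : A → A → A) : Prop where
  l : ∀ a b c, Q a b = Q a c → b = c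
  r : ∀ a b c, Q b a = Q c a → b = c
  idem : ∀ a, Q a a = a

theorem two_cancel {m : ℕ} (hm : m % 2 = 1) (a b : ZMod m) (h : 2 * a = 2 * b) : a = b := by
  have hu : IsUnit ((2 : ℕ) : ZMod m) := by
    rw [ZMod.isUnit_iff_coprime]
    exact (Nat.coprime_two_left).mpr (Nat.odd_iff.mpr hm)
  push_cast at hu
  exact hu.mul_left_cancel h

theorem idem_odd (m : ℕ) (hm : m % 2 = 1) : Idem (fun x y : ZMod m => 2 * x - y) where
  l := by intro a b c h; exact sub_right_injective h
  r := by intro a b c h; exact two_cancel hm _ _ (sub_left_injective h)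
  idem := by intro a; ring

/-- even order idempotent quasigroup -/
def qe (m : ℕ) : Option (ZMod m) → Option (ZMod m) → Option (ZMod m)
  | some x, some y => if y = x + 1 then none else some (2 * x - y)
  | some x, none => some (x - 1)
  | none, some y => some (y - 2)
  | none, none => none

theorem idem_even (m : ℕ) (hm : m % 2 = 1) (h3 : 3 ≤ m) : Idem (qe m) where
  l := by
    rintro (_ | a) (_ | b) (_ | c) h <;> simp only [qe] at h <;> (try split_ifs at h) <;>
      simp at h ⊢ <;> grind
  r := by
    have tc := two_cancel hm
    have t1 : ∀ a c : ZMod m, a - 2 = 2 * c - a → a = c + 1 := by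
      intro a c h
      apply tc
      linear_combination h
    rintro (_ | a) (_ | b) (_ | c) h <;> simp only [qe] at h <;> (try split_ifs at h) <;>
      simp at h ⊢ <;> grind
  idem := by
    have : Fact (1 < m) := ⟨by omega⟩
    rintro (_ | a)
    · rfl
    · simp [qe]; ring

theorem exists_idem (m : ℕ) (hm : 3 ≤ m) :
    ∃ (A : Type) (_ : Fintype A) (Q : A → A → A), Fintype.card A = m ∧ Idem Q := by
  rcases Nat.even_or_odd m with h | h
  · have hm' : NeZero (m - 1) := ⟨by omega⟩
    have := Nat.even_iff.mp h
    exact ⟨Option (ZMod (m - 1)), inferInstance, qe (m - 1), by simp [ZMod.card]; omega,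
      idem_even _ (by omega) (by omega)⟩
  · have hm' : NeZero m := ⟨by omega⟩
    exact ⟨ZMod m, inferInstance, _, ZMod.card m, idem_odd m (Nat.odd_iff.mp h)⟩

section
variable {A : Type} [DecidableEq A]

/-- order three group -/
def P : Option Bool → Option Bool → Option Bool
  | none, b => b
  | a, none => a
  | some false, some false => some true
  | some true, some true => some false
  | _, _ => none

/-- doubled and prolonged quasigroup -/
def LL (Q : A → A → A) : Option (A × Bool) → Option (A × Bool) → Option (A × Bool)
  | some (a, b), some (a', b') =>
      if a = a' then (P (some b) (some b')).map (fun c => (a, c)) else some (Q a a', xor b b')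
  | some (a, b), none => some (a, b)
  | none, y => y

/-- the involution -/
def sg : Option (A × Bool) → Option (A × Bool)
  | some (a, b) => some (a, !b)
  | none => none

/-- the region -/
def RR : Option (A × Bool) → Option (A × Bool) → Prop
  | some (a, _), some (a', _) => a ≠ a'
  | _, _ => False

theorem compatLL {Q : A → A → A} (hQ : Idem Q) : Compat sg (LL Q) RR where
  inv := by rintro (_ | ⟨a, b⟩) <;> simp [sg]
  l := by
    have hl := hQ.l
    have hi := hQ.idem
    have hj : ∀ a c, Q a c = a → a = c := fun a c h => hl a _ _ ((hi a).trans h.symm)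
    rintro (_ | ⟨a, a'⟩) (_ | ⟨b, b'⟩) (_ | ⟨c, c'⟩) h <;> simp only [LL] at h <;>
      (try split_ifs at h) <;> revert h <;> (try cases a') <;> (try cases b') <;>
      (try cases c') <;> simp [P] <;> grind
  r := by
    have hr := hQ.r
    have hi := hQ.idem
    have hj : ∀ a c, Q c a = a → a = c := fun a c h => hr a _ _ ((hi a).trans h.symm)
    rintro (_ | ⟨a, a'⟩) (_ | ⟨b, b'⟩) (_ | ⟨c, c'⟩) h <;> simp only [LL] at h <;>
      (try split_ifs at h) <;> revert h <;> (try cases a') <;> (try cases b') <;>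
      (try cases c') <;> simp [P] <;> grind
  sl := by
    rintro (_ | ⟨a, a'⟩) (_ | ⟨b, b'⟩) h <;> simp_all [RR, LL, sg]
  sr := by
    rintro (_ | ⟨a, a'⟩) (_ | ⟨b, b'⟩) h <;> simp_all [RR, LL, sg]

theorem odd_struct [Fintype A] (Q : A → A → A) (hQ : Idem Q) (n : ℕ) :
    ∃ (I : Type) (_ : Fintype I) (_ : DecidableEq I)
      (f : (I → Option (A × Bool)) → Option (A × Bool)) (ι : Type)
      (c : (I → Option (A × Bool)) → Option ι) (H : Finset ι) (p : ι → A),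
      Fintype.card I = n + 1 ∧
      H.card = Fintype.card A * (Fintype.card A - 1) ^ n ∧ Good sg f c ∧
      ∀ t ∈ H, ∃ x b, c x = some t ∧ f x = some (p t, b) := by
  have base : Good (I := Unit) (ι := A) sg (fun x => x ())
      (fun x => (x ()).map Prod.fst) := by
    constructor
    · intro i x a b h
      simpa using h
    · intro x i a h
      simp at h
      subst h
      rcases hx : x () with _ | ⟨a, b⟩ <;> simp [sg, hx]
  induction n with
  | zero =>
    refine ⟨Unit, inferInstance, inferInstance, _, A, _, Finset.univ, id, by simp, by simp,
      base, ?_⟩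
    intro t _
    exact ⟨fun _ => some (t, false), false, by simp, by simp⟩
  | succ n ih =>
    classical
    obtain ⟨I, _, _, f, ι, c, H, p, hI, hc, hg, hH⟩ := ih
    refine ⟨Unit ⊕ I, inferInstance, inferInstance, _, A × ι, _,
      H.biUnion (fun t => (Finset.univ.erase (p t)).image (fun i => (i, t))),
      fun u => Q u.1 (p u.2), by simp [hI]; omega, ?_, base.comb (compatLL hQ) hg, ?_⟩
    · rw [Finset.card_biUnion]
      · have : ∀ t ∈ H, ((Finset.univ.erase (p t)).image (fun i => (i, t))).card
            = Fintype.card A - 1 := by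
          intro t _
          rw [Finset.card_image_of_injective _ (fun i j h => (Prod.mk.inj h).1)]
          simp
        rw [Finset.sum_congr rfl this]
        simp [hc, pow_succ, mul_assoc]
      · intro t _ u _ htu
        rw [Function.onFun, Finset.disjoint_left]
        simp
        grind
    · rintro ⟨i, t⟩ h
      simp at h
      obtain ⟨hi, ht⟩ : i ≠ p t ∧ t ∈ H := by grind
      obtain ⟨x, b, hx, hx'⟩ := hH t ht
      have := comb_hit (LL Q) (R := RR) (f := fun x : Unit → Option (A × Bool) => x ()) (g := f)
        (c := fun x => (x ()).map Prod.fst) (d := c)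
        (fun _ => some (i, false)) x i t (by simp) hx (by simp [hx', RR, hi])
      refine ⟨_, b, this.1, ?_⟩
      rw [this.2, hx']
      simp [LL, hi]

end

theorem odd_bound (n m : ℕ) (hm : 3 ≤ m) :
    2 ^ (m * (m - 1) ^ n) ≤ numQuasigroups (n + 1) (2 * m + 1) := by
  classical
  obtain ⟨A, _, Q, rfl, hQ⟩ := exists_idem m hm
  obtain ⟨I, _, _, f, ι, c, H, p, hI, hc, hg, hH⟩ := odd_struct Q hQ n
  rw [← hc]
  refine hg.count (compatLL hQ).inv _ _ hI (by simp; ring) H ?_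
  intro t ht
  obtain ⟨x, b, hx, hx'⟩ := hH t ht
  exact ⟨x, hx, by rw [hx']; simp [sg]⟩

end QG

/-- Summary lower bounds on the number of `n`-ary quasigroups of order `k > 3`:
(a) even `k`; (b) `3 ∣ k`; (c) `k = 5`, with a constant `c < 0.072` depending only
on `n mod 3`; (d) the remaining cases. -/
theorem numQuasigroups_lower_bounds :
    (∀ n k : ℕ, 2 ≤ n → 3 < k → 2 ∣ k →
      numQuasigroups n k ≥ 2 ^ (k / 2) ^ n) ∧
    (∀ n k : ℕ, 2 ≤ n → 3 < k → 3 ∣ k →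
      numQuasigroups n k ≥ 2 ^ (n * (k / 3) ^ n)) ∧
    (∃ c : ℕ → ℝ, (∀ j : ℕ, c j < 0.072) ∧
      ∀ n : ℕ, 2 ≤ n →
        (numQuasigroups n 5 : ℝ) ≥ (2 : ℝ) ^ ((3 : ℝ) ^ ((n : ℝ) / 3 - c (n % 3)))) ∧
    (∀ n k : ℕ, 2 ≤ n → 3 < k → ¬ 2 ∣ k → ¬ 3 ∣ k →
      numQuasigroups n k ≥ 2 ^ (k / 2 * (k / 3) ^ (n - 1)) ∧
      ((2 : ℝ) ^ (k / 2 * (k / 3) ^ (n - 1) : ℕ) ≥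
        (2 : ℝ) ^ (1.5 * ((k / 3 : ℕ) : ℝ) ^ n)) ) := by
  refine ⟨fun n k _ hk h => QG.part_a n k hk h, fun n k _ hk h => QG.part_b n k hk h,
    ⟨fun _ => 14 / 195, fun _ => by norm_num, ?_⟩, ?_⟩
  · intro n hn
    obtain ⟨n, rfl⟩ := Nat.exists_eq_add_of_le' hn
    obtain ⟨N, h1, h2, h3⟩ := QG.T_exists n
    have h4 : ((2 ^ N : ℕ) : ℝ) ≤ numQuasigroups (n + 2) 5 := by exact_mod_cast h1.count
    refine le_trans ?_ h4
    push_cast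
    rw [← Real.rpow_natCast]
    exact Real.rpow_le_rpow_of_exponent_le (by norm_num) (by exact_mod_cast h3)
  · intro n k hn hk hk2 hk3
    obtain ⟨n, rfl⟩ := Nat.exists_eq_add_of_le' hn
    constructor
    · by_cases h5 : k = 5
      · subst h5
        obtain ⟨N, h1, h2, h3⟩ := QG.T_exists n
        refine le_trans ?_ h1.count
        norm_num
        calc 4 = 2 ^ 2 := by norm_num
          _ ≤ 2 ^ N := Nat.pow_le_pow_right (by norm_num) h2
      · have hb := QG.odd_bound (n + 1) (k / 2) (by omega)
        have hkk : 2 * (k / 2) + 1 = k := by omega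
        rw [hkk] at hb
        refine le_trans ?_ hb
        apply Nat.pow_le_pow_right (by norm_num)
        apply Nat.mul_le_mul_left
        apply Nat.pow_le_pow_left
        omega
    · rw [← Real.rpow_natCast]
      apply Real.rpow_le_rpow_of_exponent_le (by norm_num)
      have h : 3 * (k / 3) ≤ 2 * (k / 2) := by omega
      have h' : (3 : ℝ) * ((k / 3 : ℕ) : ℝ) ≤ 2 * ((k / 2 : ℕ) : ℝ) := by exact_mod_cast h
      have e : n + 2 - 1 = n + 1 := by omega
      rw [e, Nat.cast_mul, Nat.cast_pow, pow_succ _ (n + 1)]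
      have hp : (0 : ℝ) ≤ ((k / 3 : ℕ) : ℝ) ^ (n + 1) := by positivity
      nlinarith [mul_le_mul_of_nonneg_right h' hp]
end
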